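/- Let m = ⊕_{p<0} g_p be a pseudo-product fundamental graded Lie algebra of the μ-th kind over ℂ with pseudo-product structure (e, f). If m is a free fundamental graded Lie algebra of type (n, μ), then n = 2. -/

import Mathlib

open scoped TensorProduct

/-- A ℤ-graded Lie algebra (GLA) structure over `ℂ` on a Lie algebra `L`:
a family of finite-dimensional subspaces forming an internal direct sum and
compatible with the bracket. -/
structure GLA (L : Type) [LieRing L] [LieAlgebra ℂ L] : Type where
  g : ℤ → Submodule ℂ L
  internal : DirectSum.IsInternal g
  bracket_mem : ∀ p q : ℤ, ∀ x ∈ g p, ∀ y ∈ g q, ⁅x, y⁆ ∈ g (p + q)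
  findim : ∀ p : ℤ, FiniteDimensional ℂ (g p)

namespace GLA

variable {L : Type} [LieRing L] [LieAlgebra ℂ L]

/-- A GLA is a fundamental graded Lie algebra (FGLA): it is finite-dimensional,
concentrated in negative degrees, `g₋₁ ≠ 0`, and it is generated by `g₋₁`
(i.e. `g_{p-1} = [g_p, g₋₁]` for all `p < 0`). -/
structure IsFGLA (G : GLA L) : Prop where
  fd : FiniteDimensional ℂ L
  nonneg : ∀ p : ℤ, 0 ≤ p → G.g p = ⊥
  neg_one_ne_bot : G.g (-1) ≠ ⊥
  generated : ∀ p : ℤ, p < 0 →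
    G.g (p - 1) = Submodule.span ℂ {z : L | ∃ x ∈ G.g p, ∃ y ∈ G.g (-1), z = ⁅x, y⁆}

/-- A GLA is of the `μ`-th kind (equivalently, of depth `μ`). -/
def IsOfKind (G : GLA L) (μ : ℕ) : Prop :=
  G.g (-(μ : ℤ)) ≠ ⊥ ∧ ∀ p : ℤ, p < -(μ : ℤ) → G.g p = ⊥

/-- Transitivity of a GLA. -/
def Transitive (G : GLA L) : Prop :=
  ∀ p : ℤ, 0 ≤ p → ∀ x ∈ G.g p,
    (∀ q : ℤ, q < 0 → ∀ y ∈ G.g q, ⁅x, y⁆ = 0) → x = 0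

end GLA

/-- `G` is a free fundamental graded Lie algebra of type `(n, μ)`:
it is an FGLA of the `μ`-th kind with `dim g₋₁ = n`, and every surjective linear map
from `g₋₁` onto the degree `-1` part of an FGLA of the `μ`-th kind extends uniquely
to a graded Lie algebra epimorphism. -/
def IsFreeFGLA {L : Type} [LieRing L] [LieAlgebra ℂ L] (G : GLA L) (n μ : ℕ) : Prop :=
  G.IsFGLA ∧ G.IsOfKind μ ∧ Module.finrank ℂ (G.g (-1)) = n ∧
  ∀ (L' : Type) [LieRing L'] [LieAlgebra ℂ L'] (G' : GLA L'),
    G'.IsFGLA → G'.IsOfKind μ →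
    ∀ φ : (G.g (-1)) →ₗ[ℂ] (G'.g (-1)), Function.Surjective φ →
      ∃! Φ : L →ₗ⁅ℂ⁆ L',
        (∀ p : ℤ, ∀ x ∈ G.g p, Φ x ∈ G'.g p) ∧ Function.Surjective Φ ∧
        ∀ x : G.g (-1), Φ (x : L) = (φ x : L')

/-- A pseudo-product FGLA: an FGLA together with nonzero subspaces `e`, `f` with
`g₋₁ = e ⊕ f` and `[e,e] = [f,f] = 0`. -/
structure IsPPFGLA {L : Type} [LieRing L] [LieAlgebra ℂ L]
    (G : GLA L) (e f : Submodule ℂ L) : Prop where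
  fgla : G.IsFGLA
  e_ne_bot : e ≠ ⊥
  f_ne_bot : f ≠ ⊥
  sup_eq : e ⊔ f = G.g (-1)
  inf_eq : e ⊓ f = ⊥
  lie_ee : ∀ x ∈ e, ∀ y ∈ e, ⁅x, y⁆ = (0 : L)
  lie_ff : ∀ x ∈ f, ∀ y ∈ f, ⁅x, y⁆ = (0 : L)

/-- `(G; e, f)` is a free pseudo-product FGLA of type `(m, n, μ)`. -/
def IsFreePPFGLA {L : Type} [LieRing L] [LieAlgebra ℂ L] (G : GLA L)
    (e f : Submodule ℂ L) (m n μ : ℕ) : Prop :=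
  IsPPFGLA G e f ∧ G.IsOfKind μ ∧
  Module.finrank ℂ e = m ∧ Module.finrank ℂ f = n ∧
  ∀ (L' : Type) [LieRing L'] [LieAlgebra ℂ L'] (G' : GLA L') (e' f' : Submodule ℂ L'),
    IsPPFGLA G' e' f' → G'.IsOfKind μ →
    ∀ φ : (G.g (-1)) →ₗ[ℂ] (G'.g (-1)), Function.Surjective φ →
      (∀ x : L, ∀ hx : x ∈ G.g (-1), x ∈ e → (φ ⟨x, hx⟩ : L') ∈ e') →
      (∀ x : L, ∀ hx : x ∈ G.g (-1), x ∈ f → (φ ⟨x, hx⟩ : L') ∈ f') →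
      ∃! Φ : L →ₗ⁅ℂ⁆ L',
        (∀ p : ℤ, ∀ x ∈ G.g p, Φ x ∈ G'.g p) ∧ Function.Surjective Φ ∧
        ∀ x : G.g (-1), Φ (x : L) = (φ x : L')

/-- `G` (on `LG`, with embedding `ι` of `Lm`) is the prolongation of the FGLA `M`:
`ι` embeds `M` as the negative part of `G`, `G` is transitive, and `G` is maximal among
transitive GLAs with negative part `M`. -/
structure IsProlongation {Lm LG : Type} [LieRing Lm] [LieAlgebra ℂ Lm]
    [LieRing LG] [LieAlgebra ℂ LG] (M : GLA Lm) (G : GLA LG)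
    (ι : Lm →ₗ⁅ℂ⁆ LG) : Prop where
  inj : Function.Injective ι
  graded_neg : ∀ p : ℤ, p < 0 → (M.g p).map ι.toLinearMap = G.g p
  trans : G.Transitive
  max : ∀ (LH : Type) [LieRing LH] [LieAlgebra ℂ LH] (H : GLA LH) (j : Lm →ₗ⁅ℂ⁆ LH),
    Function.Injective j → (∀ p : ℤ, p < 0 → (M.g p).map j.toLinearMap = H.g p) →
    H.Transitive →
    ∃ ψ : LH →ₗ⁅ℂ⁆ LG, Function.Injective ψ ∧
      (∀ p : ℤ, (H.g p).map ψ.toLinearMap ≤ G.g p) ∧ ψ.comp j = ι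

/-- `G` (with embedding `ι`) is the prolongation of the pseudo-product FGLA `(M; e, f)`:
the negative part is `M`, `G` is transitive, the degree-0 part preserves `e` and `f`,
and `G` is maximal among such transitive GLAs. -/
structure IsPPProlongation {Lm LG : Type} [LieRing Lm] [LieAlgebra ℂ Lm]
    [LieRing LG] [LieAlgebra ℂ LG] (M : GLA Lm) (e f : Submodule ℂ Lm) (G : GLA LG)
    (ι : Lm →ₗ⁅ℂ⁆ LG) : Prop where
  inj : Function.Injective ι
  graded_neg : ∀ p : ℤ, p < 0 → (M.g p).map ι.toLinearMap = G.g p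
  trans : G.Transitive
  e_stable : ∀ x ∈ G.g 0, ∀ y ∈ e, ⁅x, ι y⁆ ∈ e.map ι.toLinearMap
  f_stable : ∀ x ∈ G.g 0, ∀ y ∈ f, ⁅x, ι y⁆ ∈ f.map ι.toLinearMap
  max : ∀ (LH : Type) [LieRing LH] [LieAlgebra ℂ LH] (H : GLA LH) (j : Lm →ₗ⁅ℂ⁆ LH),
    Function.Injective j → (∀ p : ℤ, p < 0 → (M.g p).map j.toLinearMap = H.g p) →
    H.Transitive →
    (∀ x ∈ H.g 0, ∀ y ∈ e, ⁅x, j y⁆ ∈ e.map j.toLinearMap) →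
    (∀ x ∈ H.g 0, ∀ y ∈ f, ⁅x, j y⁆ ∈ f.map j.toLinearMap) →
    ∃ ψ : LH →ₗ⁅ℂ⁆ LG, Function.Injective ψ ∧
      (∀ p : ℤ, (H.g p).map ψ.toLinearMap ≤ G.g p) ∧ ψ.comp j = ι

/-- `G` is a finite-dimensional simple graded Lie algebra of type `(A, Pi1)`, where `A`
is the Cartan matrix (with convention `⁅hᵢ, eⱼ⁆ = Aᵢⱼ • eⱼ`) and `Pi1` is the set of
simple roots of degree one: there is a set of Chevalley generators compatible with the
grading, the generators `eᵢ` (resp. `fᵢ`) having degree `1` (resp. `-1`) for `i ∈ Pi1`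
and degree `0` otherwise. -/
def IsSimpleGLAOfType {LG : Type} [LieRing LG] [LieAlgebra ℂ LG] (G : GLA LG)
    {l : ℕ} (A : Matrix (Fin l) (Fin l) ℤ) (Pi1 : Finset (Fin l)) : Prop :=
  FiniteDimensional ℂ LG ∧ LieAlgebra.IsSimple ℂ LG ∧
  ∃ h e f : Fin l → LG,
    LinearIndependent ℂ h ∧ (∀ i, e i ≠ 0) ∧ (∀ i, f i ≠ 0) ∧
    (∀ i j, ⁅h i, h j⁆ = 0) ∧
    (∀ i, ⁅e i, f i⁆ = h i) ∧ (∀ i j, i ≠ j → ⁅e i, f j⁆ = 0) ∧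
    (∀ i j, ⁅h i, e j⁆ = A i j • e j) ∧
    (∀ i j, ⁅h i, f j⁆ = (-(A i j)) • f j) ∧
    LieSubalgebra.lieSpan ℂ LG (Set.range e ∪ Set.range f) = ⊤ ∧
    (∀ i, h i ∈ G.g 0) ∧
    (∀ i, e i ∈ G.g (if i ∈ Pi1 then 1 else 0)) ∧
    (∀ i, f i ∈ G.g (-(if i ∈ Pi1 then 1 else 0)))

/-- The Cartan matrix of type `A_l` (Bourbaki numbering, 0-indexed). -/
def cartanA (l : ℕ) : Matrix (Fin l) (Fin l) ℤ :=
  Matrix.of fun i j =>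
    if i = j then 2
    else if (i : ℕ) + 1 = (j : ℕ) ∨ (j : ℕ) + 1 = (i : ℕ) then -1 else 0

/-- The Cartan matrix of type `B_l` (Bourbaki numbering, 0-indexed; the last simple
root is the short one), with convention `⁅hᵢ, eⱼ⁆ = Aᵢⱼ • eⱼ`, i.e. `Aᵢⱼ = αⱼ(hᵢ)`. -/
def cartanB (l : ℕ) : Matrix (Fin l) (Fin l) ℤ :=
  Matrix.of fun i j =>
    if i = j then 2
    else if (i : ℕ) = l - 1 ∧ (j : ℕ) + 1 = (i : ℕ) then -2
    else if (i : ℕ) + 1 = (j : ℕ) ∨ (j : ℕ) + 1 = (i : ℕ) then -1 else 0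

/-- The Cartan matrix of type `G₂` (Bourbaki numbering, 0-indexed; `α₁` is the short
root), with convention `⁅hᵢ, eⱼ⁆ = Aᵢⱼ • eⱼ`, i.e. `Aᵢⱼ = αⱼ(hᵢ)`. -/
def cartanG2 : Matrix (Fin 2) (Fin 2) ℤ := !![2, -3; -1, 2]

/-- A pseudo-product graded Lie algebra: a transitive GLA whose negative part is an
FGLA equipped with a pseudo-product structure `(e, f)` preserved by `g₀`. -/
structure IsPseudoProductGLA {L : Type} [LieRing L] [LieAlgebra ℂ L]
    (G : GLA L) (e f : Submodule ℂ L) : Prop where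
  trans : G.Transitive
  e_ne_bot : e ≠ ⊥
  f_ne_bot : f ≠ ⊥
  sup_eq : e ⊔ f = G.g (-1)
  inf_eq : e ⊓ f = ⊥
  lie_ee : ∀ x ∈ e, ∀ y ∈ e, ⁅x, y⁆ = (0 : L)
  lie_ff : ∀ x ∈ f, ∀ y ∈ f, ⁅x, y⁆ = (0 : L)
  neg_one_ne_bot : G.g (-1) ≠ ⊥
  generated : ∀ p : ℤ, p < 0 →
    G.g (p - 1) = Submodule.span ℂ {z : L | ∃ x ∈ G.g p, ∃ y ∈ G.g (-1), z = ⁅x, y⁆}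
  depth_bdd : ∃ μ : ℕ, ∀ p : ℤ, p < -(μ : ℤ) → G.g p = ⊥
  e_stable : ∀ x ∈ G.g 0, ∀ y ∈ e, ⁅x, y⁆ ∈ e
  f_stable : ∀ x ∈ G.g 0, ∀ y ∈ f, ⁅x, y⁆ ∈ f

/-- The symmetric square `S²(V)` of a vector space, realized as the subspace of
symmetric tensors in `V ⊗ V`. -/
noncomputable def symSq (V : Type) [AddCommGroup V] [Module ℂ V] : Submodule ℂ (TensorProduct ℂ V V) :=
  LinearMap.eqLocus (TensorProduct.comm ℂ V V).toLinearMap LinearMap.id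

lemma tmul_self_mem_symSq {V : Type} [AddCommGroup V] [Module ℂ V] (x : V) :
    x ⊗ₜ[ℂ] x ∈ symSq V := by
  show (TensorProduct.comm ℂ V V).toLinearMap (x ⊗ₜ[ℂ] x) = LinearMap.id (x ⊗ₜ[ℂ] x)
  simp
/-- The underlying space of the filiform Lie algebra of depth `μ`: it has a basis
`Y₀, Y₁, …, Y_μ` whose only nonzero brackets are `⁅Y₀, Yⱼ⁆ = Yⱼ₊₁` for `1 ≤ j < μ`. -/
abbrev FiliformSpace (μ : ℕ) : Type := Fin (μ + 1) → ℂ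

/-- A type synonym of `FiliformSpace` carrying the filiform bracket. -/
def Filiform (μ : ℕ) : Type := FiliformSpace μ

namespace Filiform

variable {μ : ℕ}

noncomputable instance : AddCommGroup (Filiform μ) :=
  inferInstanceAs (AddCommGroup (FiliformSpace μ))

noncomputable instance : Module ℂ (Filiform μ) :=
  inferInstanceAs (Module ℂ (FiliformSpace μ))

instance : FiniteDimensional ℂ (Filiform μ) :=
  inferInstanceAs (FiniteDimensional ℂ (FiliformSpace μ))

/-- The coordinates of an element of the filiform Lie algebra. -/
def coord (v : Filiform μ) (j : Fin (μ + 1)) : ℂ := v j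

/-- The element of the filiform Lie algebra with given coordinates. -/
def mk (c : Fin (μ + 1) → ℂ) : Filiform μ := c

@[simp] lemma coord_mk (c : Fin (μ + 1) → ℂ) (j : Fin (μ + 1)) : (mk c).coord j = c j := rfl

@[simp] lemma coord_add (v w : Filiform μ) (j : Fin (μ + 1)) :
    (v + w).coord j = v.coord j + w.coord j := rfl

@[simp] lemma coord_smul (a : ℂ) (v : Filiform μ) (j : Fin (μ + 1)) :
    (a • v).coord j = a * v.coord j := rfl

@[simp] lemma coord_zero (j : Fin (μ + 1)) : (0 : Filiform μ).coord j = 0 := rfl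

@[ext] lemma ext {v w : Filiform μ} (h : ∀ j, v.coord j = w.coord j) : v = w := funext h

/-- The index preceding `j`. -/
def prev (j : Fin (μ + 1)) : Fin (μ + 1) := ⟨j - 1, by omega⟩

noncomputable instance : Bracket (Filiform μ) (Filiform μ) where
  bracket v w := mk fun j =>
    if 2 ≤ (j : ℕ) then v.coord 0 * w.coord (prev j) - w.coord 0 * v.coord (prev j) else 0

lemma coord_lie (v w : Filiform μ) (j : Fin (μ + 1)) :
    ⁅v, w⁆.coord j = if 2 ≤ (j : ℕ) then
      v.coord 0 * w.coord (prev j) - w.coord 0 * v.coord (prev j) else 0 := rfl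

@[simp] lemma coord_lie_zero (v w : Filiform μ) : ⁅v, w⁆.coord 0 = 0 := by
  simp [coord_lie]

noncomputable instance : LieRing (Filiform μ) where
  add_lie u v w := by
    ext j
    simp only [coord_lie, coord_add]
    split_ifs <;> ring
  lie_add u v w := by
    ext j
    simp only [coord_lie, coord_add]
    split_ifs <;> ring
  lie_self v := by
    ext j
    simp [coord_lie]
  leibniz_lie u v w := by
    ext j
    rw [coord_add, coord_lie u, coord_lie ⁅u, v⁆, coord_lie v ⁅u, w⁆]
    simp only [coord_lie_zero, coord_lie _ _ (prev j)]
    split_ifs <;> ring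

noncomputable instance : LieAlgebra ℂ (Filiform μ) where
  lie_smul a v w := by
    ext j
    simp only [coord_lie, coord_smul]
    split_ifs <;> ring

/-- The degree of the `j`-th basis vector. -/
def deg (j : Fin (μ + 1)) : ℤ := -(max 1 (j : ℕ) : ℕ)

/-- The homogeneous component of degree `p`. -/
def component (μ : ℕ) (p : ℤ) : Submodule ℂ (Filiform μ) where
  carrier := {v | ∀ j, deg j ≠ p → v.coord j = 0}
  add_mem' hv hw j hj := by simp [hv j hj, hw j hj]
  zero_mem' j _ := by simp
  smul_mem' a v hv j hj := by simp [hv j hj]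

/-- The vectors with no component in degree `p`. -/
def complement (μ : ℕ) (p : ℤ) : Submodule ℂ (Filiform μ) where
  carrier := {v | ∀ j, deg j = p → v.coord j = 0}
  add_mem' hv hw j hj := by simp [hv j hj, hw j hj]
  zero_mem' j _ := by simp
  smul_mem' a v hv j hj := by simp [hv j hj]

lemma component_isInternal (μ : ℕ) : DirectSum.IsInternal (component μ) := by
  rw [DirectSum.isInternal_submodule_iff_iSupIndep_and_iSup_eq_top]
  constructor
  · intro p
    have hle : ⨆ q, ⨆ (_ : q ≠ p), component μ q ≤ complement μ p :=
      iSup₂_le fun q hq v hv j hj => hv j fun h => hq (h.symm.trans hj)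
    refine Disjoint.mono_right hle ?_
    rw [Submodule.disjoint_def]
    intro v hv hv'
    ext j
    by_cases hj : deg j = p
    · exact hv' j hj
    · exact hv j hj
  · rw [eq_top_iff]
    intro v _
    have hv : v = ∑ j, mk (Pi.single j (v.coord j)) := by
      exact (Finset.univ_sum_single (v : FiliformSpace μ)).symm
    rw [hv]
    refine Submodule.sum_mem _ fun j _ => Submodule.mem_iSup_of_mem (deg j) ?_
    intro k hk
    have hkj : k ≠ j := fun h => hk (h ▸ rfl)
    simp [hkj]

lemma lie_mem_component {p q : ℤ} {v w : Filiform μ} (hv : v ∈ component μ p)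
    (hw : w ∈ component μ q) : ⁅v, w⁆ ∈ component μ (p + q) := by
  have key : ∀ {p q : ℤ} {v w : Filiform μ}, v ∈ component μ p → w ∈ component μ q →
      ∀ j : Fin (μ + 1), 2 ≤ (j : ℕ) → deg j ≠ p + q → v.coord 0 * w.coord (prev j) = 0 := by
    intro p q v w hv hw j hj hd
    by_cases h0 : deg (0 : Fin (μ + 1)) = p
    · rw [hw (prev j), mul_zero]
      intro h
      simp only [deg, prev, Fin.val_zero] at h0 h hd
      omega
    · rw [hv 0 h0, zero_mul]
  intro j hj
  rw [coord_lie]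
  split_ifs with h2
  · rw [key hv hw j h2 hj, key hw hv j h2 (by rwa [add_comm]), sub_zero]
  · rfl

/-- The standard grading of the filiform Lie algebra. -/
noncomputable def gla (μ : ℕ) : GLA (Filiform μ) where
  g := component μ
  internal := component_isInternal μ
  bracket_mem _ _ _ hv _ hw := lie_mem_component hv hw
  findim _ := inferInstance

/-- The first generator `Y₀`. -/
def genX (μ : ℕ) : Filiform μ := mk fun j => if (j : ℕ) = 0 then 1 else 0

/-- The second generator `Y₁`. -/
def genY (μ : ℕ) : Filiform μ := mk fun j => if (j : ℕ) = 1 then 1 else 0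

lemma genX_mem (μ : ℕ) : genX μ ∈ component μ (-1) := by
  intro j hj
  simp only [genX, coord_mk]
  rw [if_neg]
  intro h
  simp [deg, h] at hj

lemma genY_mem (μ : ℕ) : genY μ ∈ component μ (-1) := by
  intro j hj
  simp only [genY, coord_mk]
  rw [if_neg]
  intro h
  simp [deg, h] at hj

lemma genX_ne_zero (μ : ℕ) : genX μ ≠ 0 := by
  intro h
  have := congrArg (fun v => v.coord 0) h
  simp [genX] at this

lemma lie_gen_ne_zero (hμ : 2 ≤ μ) : ⁅genX μ, genY μ⁆ ≠ 0 := by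
  intro h
  have := congrArg (fun v => v.coord ⟨2, by omega⟩) h
  simp [genX, genY, coord_lie, prev] at this

lemma exists_eq_smul_add_smul (hμ : 1 ≤ μ) {v : Filiform μ} (hv : v ∈ component μ (-1)) :
    ∃ a b : ℂ, v = a • genX μ + b • genY μ := by
  refine ⟨v.coord 0, v.coord ⟨1, by omega⟩, ?_⟩
  ext ⟨j, hj⟩
  rcases j with _ | _ | j
  · simp [genX, genY]
  · simp [genX, genY]
  · rw [hv _ (by simp only [deg]; omega)]
    simp [genX, genY]

lemma exists_lie_genX_eq {p : ℤ} (hp : p < 0) {v : Filiform μ}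
    (hv : v ∈ component μ (p - 1)) : ∃ w ∈ component μ p, v = ⁅w, genX μ⁆ := by
  refine ⟨mk fun k => if (k : ℕ) = 0 then 0 else
    if h : (k : ℕ) + 1 < μ + 1 then -v.coord ⟨k + 1, h⟩ else 0, ?_, ?_⟩
  · intro k hk
    rw [coord_mk]
    split_ifs with h0 h
    · rfl
    · rw [hv, neg_zero]
      simp only [deg] at hk ⊢
      omega
    · rfl
  · ext j
    rw [coord_lie]
    split_ifs with hj
    · have h1 : ((prev j : Fin (μ + 1)) : ℕ) ≠ 0 := by simp only [prev]; omega
      have h2 : ((prev j : Fin (μ + 1)) : ℕ) + 1 = j := by simp only [prev]; omega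
      have h3 : (j : ℕ) < μ + 1 := j.isLt
      simp only [genX, coord_mk, if_neg h1, h2, dif_pos h3, Fin.val_zero, if_true]
      ring
    · rw [hv]
      simp only [deg]
      omega

lemma gla_isFGLA (μ : ℕ) : (gla μ).IsFGLA where
  fd := inferInstance
  nonneg p hp := by
    rw [eq_bot_iff]
    intro v hv
    refine (Submodule.mem_bot ℂ).2 (ext fun j => hv j ?_)
    simp only [deg]
    omega
  neg_one_ne_bot := (Submodule.ne_bot_iff _).2 ⟨genX μ, genX_mem μ, genX_ne_zero μ⟩
  generated p hp := by
    apply le_antisymm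
    · intro v hv
      obtain ⟨w, hw, rfl⟩ := exists_lie_genX_eq hp hv
      exact Submodule.subset_span ⟨w, hw, genX μ, genX_mem μ, rfl⟩
    · rw [Submodule.span_le]
      rintro _ ⟨x, hx, y, hy, rfl⟩
      exact lie_mem_component hx hy

lemma gla_isOfKind (hμ : 1 ≤ μ) : (gla μ).IsOfKind μ := by
  constructor
  · refine (Submodule.ne_bot_iff _).2 ⟨mk fun j => if (j : ℕ) = μ then 1 else 0, ?_, ?_⟩
    · intro j hj
      rw [coord_mk, if_neg]
      intro h
      simp only [deg] at hj
      omega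
    · intro h
      have := congrArg (fun v => v.coord ⟨μ, by omega⟩) h
      simp at this
  · intro p hp
    rw [eq_bot_iff]
    intro v hv
    refine (Submodule.mem_bot ℂ).2 (ext fun j => hv j ?_)
    simp only [deg]
    omega

end Filiform

/-- Two linearly independent vectors can be mapped to any two prescribed vectors. -/
lemma LinearIndependent.exists_linearMap_pair {K V W : Type*} [Field K] [AddCommGroup V]
    [Module K V] [AddCommGroup W] [Module K W] {x y : V} (h : LinearIndependent K ![x, y])
    (a b : W) : ∃ φ : V →ₗ[K] W, φ x = a ∧ φ y = b := by
  obtain ⟨ψ, hψ⟩ := LinearMap.exists_leftInverse_of_injective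
    (Fintype.linearCombination K ![x, y])
    (LinearMap.ker_eq_bot.2 h.fintypeLinearCombination_injective)
  have hψ' (c : Fin 2 → K) : ψ (Fintype.linearCombination K ![x, y] c) = c :=
    LinearMap.congr_fun hψ c
  refine ⟨(Fintype.linearCombination K ![a, b]).comp ψ, ?_, ?_⟩
  · have := hψ' ![1, 0]
    simp [Fintype.linearCombination_apply] at this
    simp [this, Fintype.linearCombination_apply]
  · have := hψ' ![0, 1]
    simp [Fintype.linearCombination_apply] at this
    simp [this, Fintype.linearCombination_apply]

/-- In a free FGLA, linearly independent elements of degree `-1` do not commute. -/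
lemma IsFreeFGLA.lie_ne_zero {L : Type} [LieRing L] [LieAlgebra ℂ L] {G : GLA L} {n μ : ℕ}
    (hμ : 2 ≤ μ) (hfree : IsFreeFGLA G n μ) {x y : G.g (-1)}
    (hxy : LinearIndependent ℂ ![x, y]) : ⁅(x : L), (y : L)⁆ ≠ 0 := by
  obtain ⟨φ, hx, hy⟩ := hxy.exists_linearMap_pair
    (⟨Filiform.genX μ, Filiform.genX_mem μ⟩ : (Filiform.gla μ).g (-1))
    ⟨Filiform.genY μ, Filiform.genY_mem μ⟩
  have hφ : Function.Surjective φ := by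
    rintro ⟨v, hv⟩
    obtain ⟨a, b, rfl⟩ := Filiform.exists_eq_smul_add_smul (by omega) hv
    refine ⟨a • x + b • y, ?_⟩
    rw [map_add, map_smul, map_smul, hx, hy]
    rfl
  obtain ⟨Φ, ⟨-, -, hΦ⟩, -⟩ := hfree.2.2.2 (Filiform μ) (Filiform.gla μ)
    (Filiform.gla_isFGLA μ) (Filiform.gla_isOfKind (by omega)) φ hφ
  intro h
  apply Filiform.lie_gen_ne_zero hμ
  have h' := congrArg Φ h
  rwa [LieHom.map_lie, hΦ, hΦ, hx, hy, map_zero] at h'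

/-- In a free FGLA, a commutative subspace of degree `-1` is at most one-dimensional. -/
lemma IsFreeFGLA.finrank_le_one {L : Type} [LieRing L] [LieAlgebra ℂ L] {G : GLA L} {n μ : ℕ}
    (hμ : 2 ≤ μ) (hfree : IsFreeFGLA G n μ) {e : Submodule ℂ L} (he : e ≤ G.g (-1))
    (hlie : ∀ x ∈ e, ∀ y ∈ e, ⁅x, y⁆ = (0 : L)) : Module.finrank ℂ e ≤ 1 := by
  by_contra! h
  have : Nontrivial e := Module.nontrivial_of_finrank_pos (R := ℂ) (by omega)
  obtain ⟨x, hx⟩ := exists_ne (0 : e)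
  obtain ⟨y, hxy⟩ := exists_linearIndependent_pair_of_one_lt_finrank h hx
  have hxy' := hxy.map' (Submodule.inclusion he)
    (LinearMap.ker_eq_bot.2 (Submodule.inclusion_injective he))
  have hcomp : Submodule.inclusion he ∘ ![x, y] =
      ![Submodule.inclusion he x, Submodule.inclusion he y] := by
    ext i
    fin_cases i <;> rfl
  rw [hcomp] at hxy'
  exact hfree.lie_ne_zero hμ hxy' (hlie x x.2 y y.2)

/-- If a pseudo-product FGLA of the `μ`-th kind is a free FGLA of type `(n, μ)`,
then `n = 2`. -/
theorem pp_fgla_free_implies_rank_two {L : Type} [LieRing L] [LieAlgebra ℂ L]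
    (G : GLA L) (e f : Submodule ℂ L) (n μ : ℕ) (hμ : 2 ≤ μ)
    (hpp : IsPPFGLA G e f) (hkind : G.IsOfKind μ)
    (hfree : IsFreeFGLA G n μ) : n = 2 := by
  have := hpp.fgla.fd
  have he := hfree.finrank_le_one hμ (le_sup_left.trans hpp.sup_eq.le) hpp.lie_ee
  have hf := hfree.finrank_le_one hμ (le_sup_right.trans hpp.sup_eq.le) hpp.lie_ff
  have he0 := Submodule.one_le_finrank_iff.2 hpp.e_ne_bot
  have hf0 := Submodule.one_le_finrank_iff.2 hpp.f_ne_bot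
  have hsum := Submodule.finrank_sup_add_finrank_inf_eq e f
  rw [hpp.sup_eq, hpp.inf_eq, finrank_bot, hfree.2.2.1] at hsum
  omega
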